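/- Let q = 3, so λ = 1, and let F₃ be the nearest-integer continued fraction map on [−1/2, 1/2] given by F₃(x) = −1/x − ⟨−1/x⟩₁ for x ≠ 0 and F₃(0) = 0. Set R = (√5 − 1)/2 and r = (√5 − 3)/2. Then the Borel measure μ on [−1/2, 1/2] whose density with respect to Lebesgue measure is p(u) = 1/((1 − Ru)(1 − ru)) for u ∈ [−1/2, 0] and p(u) = 1/((1 + Ru)(1 + ru)) for u ∈ (0, 1/2] is F₃-invariant: μ(F₃⁻¹(E)) = μ(E) for every Borel set E ⊆ [−1/2, 1/2]. -/

import Mathlib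

open Real MeasureTheory

/-- The modified floor function: ⌊x⌋ = n iff n < x ≤ n+1 when x > 0,
and ⌊x⌋ = n iff n ≤ x < n+1 when x ≤ 0. -/
noncomputable def mfloor (x : ℝ) : ℤ := if 0 < x then ⌈x⌉ - 1 else ⌊x⌋

/-- The density `p`, written as an even function. -/
noncomputable def evenDensity (R u : ℝ) : ℝ := 1 / ((1 + R * |u|) * (1 + (R - 1) * |u|))

/-- The contribution of the inverse branch `y ↦ -1 / (y + n)` to the transfer operator of the
nearest-integer map applied to `evenDensity R`. -/
noncomputable def transferTerm (R y : ℝ) (n : ℤ) : ℝ :=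
  if 2 ≤ |y + n| then 1 / (|y + n| + R - 1) - 1 / (|y + n| + R) else 0

lemma hasSum_one_div_telescope {c : ℝ} (hc : 0 < c) :
    HasSum (fun n : ℕ => 1 / (c + n) - 1 / (c + n + 1)) (1 / c) := by
  have hnonneg (n : ℕ) : 0 ≤ 1 / (c + n) - 1 / (c + n + 1) :=
    sub_nonneg.2 (one_div_le_one_div_of_le (by positivity) (by linarith))
  rw [hasSum_iff_tendsto_nat_of_nonneg hnonneg]
  have hsum (n : ℕ) : ∑ i ∈ Finset.range n, (1 / (c + i) - 1 / (c + i + 1))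
      = 1 / c - 1 / (c + n) := by
    have := Finset.sum_range_sub' (fun i : ℕ => 1 / (c + i)) n
    simpa [add_assoc] using this
  simp only [hsum]
  have hlim : Filter.Tendsto (fun n : ℕ => 1 / (c + (n : ℝ))) Filter.atTop (nhds 0) := by
    simp only [one_div]
    exact (Filter.tendsto_atTop_add_const_left _ c tendsto_natCast_atTop_atTop).inv_tendsto_atTop
  simpa using hlim.const_sub (1 / c)

lemma transferTerm_nonneg {R : ℝ} (h0 : 0 < R) (y : ℝ) (n : ℤ) : 0 ≤ transferTerm R y n := by
  unfold transferTerm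
  split_ifs with h
  · exact sub_nonneg.2 (one_div_le_one_div_of_le (by linarith) (by linarith))
  · exact le_rfl

lemma transferTerm_neg (R y : ℝ) (n : ℤ) : transferTerm R (-y) (-n) = transferTerm R y n := by
  have : |-y + ((-n : ℤ) : ℝ)| = |y + n| := by
    rw [← abs_neg]; congr 1; push_cast; ring
  simp only [transferTerm, this]

lemma evenDensity_neg (R y : ℝ) : evenDensity R (-y) = evenDensity R y := by
  simp [evenDensity]

lemma hasSum_transferTerm_of_pos {R y : ℝ} (h0 : 0 < R) (h1 : R < 1) (hR : R ^ 2 + R - 1 = 0)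
    (hy : 0 < y) (hy' : y < 1 / 2) :
    HasSum (transferTerm R y) (evenDensity R y) := by
  have hval : evenDensity R y = 1 / (y + 1 + R) + 1 / (2 + R - y) := by
    unfold evenDensity
    rw [abs_of_pos hy]
    have : y + 1 + R ≠ 0 := by positivity
    have : 2 + R - y ≠ 0 := by linarith
    have : 1 - R ≠ 0 := by linarith
    have e1 : 1 + R * y = R * (y + 1 + R) := by linear_combination -hR
    have e2 : 1 + (R - 1) * y = (1 - R) * (2 + R - y) := by linear_combination hR
    rw [e1, e2]
    field_simp
    linear_combination (2 * R - 1) * hR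
  rw [hval]
  apply HasSum.of_nat_of_neg_add_one
  · have e0 : transferTerm R y (0 : ℕ) = 0 :=
      if_neg (by push_cast; rw [abs_of_pos (by linarith)]; linarith)
    have e1 : transferTerm R y (1 : ℕ) = 0 :=
      if_neg (by push_cast; rw [abs_of_pos (by linarith)]; linarith)
    rw [← hasSum_nat_add_iff' 2, Finset.sum_range_succ, Finset.sum_range_one, e0, e1, add_zero,
      sub_zero]
    refine (hasSum_one_div_telescope (c := y + 1 + R) (by linarith)).congr_fun fun n => ?_
    have hn : (0 : ℝ) ≤ n := n.cast_nonneg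
    have habs : |y + (((n + 2 : ℕ) : ℤ) : ℝ)| = y + n + 2 := by
      push_cast; rw [abs_of_pos (by linarith)]; ring
    rw [transferTerm, habs, if_pos (by linarith)]
    ring_nf
  · have e0 : transferTerm R y (-((0 : ℕ) + 1)) = 0 :=
      if_neg (by push_cast; rw [abs_of_neg (by linarith)]; linarith)
    have e1 : transferTerm R y (-((1 : ℕ) + 1)) = 0 :=
      if_neg (by push_cast; rw [abs_of_neg (by linarith)]; linarith)
    rw [← hasSum_nat_add_iff' 2, Finset.sum_range_succ, Finset.sum_range_one, e0, e1, add_zero,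
      sub_zero]
    refine (hasSum_one_div_telescope (c := 2 + R - y) (by linarith)).congr_fun fun n => ?_
    have hn : (0 : ℝ) ≤ n := n.cast_nonneg
    have habs : |y + ((-(((n + 2 : ℕ) : ℤ) + 1) : ℤ) : ℝ)| = n + 3 - y := by
      push_cast; rw [abs_of_neg (by linarith)]; ring
    rw [transferTerm, habs, if_pos (by linarith)]
    ring_nf

lemma hasSum_transferTerm {R y : ℝ} (h0 : 0 < R) (h1 : R < 1) (hR : R ^ 2 + R - 1 = 0)
    (hy : y ≠ 0) (hy' : |y| < 1 / 2) :
    HasSum (transferTerm R y) (evenDensity R y) := by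
  rcases hy.lt_or_gt with h | h
  · have := hasSum_transferTerm_of_pos h0 h1 hR (neg_pos.2 h) (by rwa [abs_of_neg h] at hy')
    rw [evenDensity_neg, ← (Equiv.neg ℤ).hasSum_iff] at this
    convert this using 1
    ext n
    exact (transferTerm_neg R y n).symm
  · exact hasSum_transferTerm_of_pos h0 h1 hR h (by rwa [abs_of_pos h] at hy')

/-- The Jacobian of the inverse branch times the density along it is `transferTerm`. -/
lemma inv_sq_mul_evenDensity {R y : ℝ} {n : ℤ} (h0 : 0 < R) (h : 2 ≤ |y + n|) :
    |((y + n) ^ 2)⁻¹| * evenDensity R (-1 / (y + n)) = transferTerm R y n := by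
  rw [transferTerm, if_pos h, evenDensity, abs_inv, abs_pow, abs_div, abs_neg, abs_one]
  generalize |y + (n : ℝ)| = w at h
  have : w ≠ 0 := by linarith
  have : w + R ≠ 0 := by linarith
  have : w + R - 1 ≠ 0 := by linarith
  have e1 : 1 + R * (1 / w) = (w + R) / w := by field_simp
  have e2 : 1 + (R - 1) * (1 / w) = (w + R - 1) / w := by field_simp; ring
  rw [e1, e2]
  field_simp
  ring

lemma mfloor_eq_of_mem_Ioo {x : ℝ} {n : ℤ} (h : (n : ℝ) < x) (h' : x < n + 1) : mfloor x = n := by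
  unfold mfloor
  split_ifs
  · have : ⌈x⌉ = n + 1 := Int.ceil_eq_iff.2 ⟨by push_cast; linarith, by push_cast; linarith⟩
    omega
  · exact Int.floor_eq_iff.2 ⟨h.le, h'⟩

/-- For q = 3 (λ = 1), the nearest-integer continued fraction map
F₃(x) = −1/x − ⟨−1/x⟩₁ on [−1/2, 1/2] preserves the measure with density
p(u) = 1/((1−Ru)(1−ru)) on [−1/2,0] and p(u) = 1/((1+Ru)(1+ru)) on (0,1/2],
where R = (√5 − 1)/2 and r = (√5 − 3)/2. -/
theorem F3_invariant_measure (R r : ℝ)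
    (hR : R = (Real.sqrt 5 - 1) / 2) (hr : r = (Real.sqrt 5 - 3) / 2)
    (F : ℝ → ℝ)
    (hF : ∀ x : ℝ, F x = if x = 0 then 0 else
      -1 / x - (mfloor (-1 / x + 1 / 2) : ℝ))
    (p : ℝ → ℝ)
    (hp : ∀ u : ℝ, p u = if u ≤ 0 then 1 / ((1 - R * u) * (1 - r * u))
      else 1 / ((1 + R * u) * (1 + r * u)))
    (μ : Measure ℝ)
    (hμ : μ = (volume.restrict (Set.Icc (-(1 / 2) : ℝ) (1 / 2))).withDensity
      (fun u => ENNReal.ofReal (p u))) :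
    ∀ E : Set ℝ, MeasurableSet E → E ⊆ Set.Icc (-(1 / 2) : ℝ) (1 / 2) →
      μ (F ⁻¹' E) = μ E := by
  intro E hE hEI
  have hs : Real.sqrt 5 ^ 2 = 5 := Real.sq_sqrt (by norm_num)
  have hs1 : 2 < Real.sqrt 5 := Real.lt_sqrt_of_sq_lt (by norm_num)
  have hs2 : Real.sqrt 5 < 3 := by rw [Real.sqrt_lt' (by norm_num)]; norm_num
  have h0 : 0 < R := by linarith
  have h1 : R < 1 := by linarith
  have hquad : R ^ 2 + R - 1 = 0 := by rw [hR]; linear_combination hs / 4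
  have hrR : r = R - 1 := by rw [hr, hR]; ring
  have hpe : p = evenDensity R := by
    ext u
    rw [hp, evenDensity, hrR]
    split_ifs with h
    · rw [abs_of_nonpos h]; ring_nf
    · rw [abs_of_pos (not_le.1 h)]
  subst hpe
  set S : Set ℝ := E ∩ {y | |y| < 1 / 2 ∧ y ≠ 0}
  have hSm : MeasurableSet S := hE.inter <|
    (measurableSet_lt measurable_id.abs measurable_const).inter (measurableSet_singleton 0).compl
  have hDm (n : ℤ) : MeasurableSet {y : ℝ | 2 ≤ |y + n|} :=
    measurableSet_le measurable_const (measurable_id.add_const _).abs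
  let D : ℤ → Set ℝ := fun n => S ∩ {y | 2 ≤ |y + n|}
  let B : ℤ → Set ℝ := fun n => {x | x ≠ 0 ∧ -1 / x - n ∈ D n}
  have hne {n : ℤ} {y : ℝ} (hy : y ∈ D n) : y + n ≠ 0 := by
    intro h
    have := hy.2
    simp only [Set.mem_ofPred_eq, h, abs_zero] at this
    linarith
  have hBm (n : ℤ) : MeasurableSet (B n) := by
    refine (measurableSet_singleton (0 : ℝ)).compl.inter ?_
    exact ((measurable_const.div measurable_id).sub_const (n : ℝ)) (hSm.inter (hDm n))
  have hBimage (n : ℤ) : B n = (fun y : ℝ => -1 / (y + n)) '' D n := by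
    ext x
    constructor
    · rintro ⟨hx, hxD⟩
      refine ⟨_, hxD, ?_⟩
      simp only [sub_add_cancel]
      field_simp
    · rintro ⟨y, hy, rfl⟩
      have := hne hy
      refine ⟨div_ne_zero (by norm_num) this, ?_⟩
      convert hy using 1
      field_simp
      ring
  have hBfloor {n : ℤ} {x : ℝ} (hx : x ∈ B n) : mfloor (-1 / x + 1 / 2) = n := by
    have := abs_lt.1 hx.2.1.2.1
    exact mfloor_eq_of_mem_Ioo (by linarith) (by linarith)
  have hBdisj : Pairwise (Function.onFun Disjoint B) := by
    intro m n hmn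
    refine Set.disjoint_left.2 fun x hm hn => hmn ?_
    rw [← hBfloor hm, hBfloor hn]
  have hBsub : (⋃ n, B n) ⊆ F ⁻¹' E ∩ Set.Icc (-(1 / 2) : ℝ) (1 / 2) := by
    refine Set.iUnion_subset fun n x hx => ⟨?_, ?_⟩
    · rw [Set.mem_preimage, hF, if_neg hx.1, hBfloor hx]
      exact hx.2.1.1
    · have h2 : 2 ≤ |-1 / x - n + n| := hx.2.2
      rw [sub_add_cancel, abs_div, abs_neg, abs_one, le_div_iff₀ (abs_pos.2 hx.1)] at h2
      exact abs_le.1 (by linarith)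
  let N : Set ℝ := {0} ∪ ⋃ n : ℤ, {-1 / ((0 : ℝ) + n), -1 / (1 / 2 + (n : ℝ)),
    -1 / (-(1 / 2) + (n : ℝ))}
  have hN : N.Countable := (Set.countable_singleton _).union <|
    Set.countable_iUnion fun n => (Set.toFinite _).countable
  have hAsub : F ⁻¹' E ∩ Set.Icc (-(1 / 2) : ℝ) (1 / 2) ⊆ (⋃ n, B n) ∪ N := by
    rintro x ⟨hxE, hxI⟩
    by_cases hxN : x ∈ N
    · exact Or.inr hxN
    left
    have hx0 : x ≠ 0 := fun h => hxN (Or.inl h)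
    have hFx := hF x
    rw [if_neg hx0] at hFx
    set n := mfloor (-1 / x + 1 / 2)
    have hxeq : x = -1 / (F x + n) := by rw [hFx, sub_add_cancel]; field_simp
    have hFN : ∀ c : ℝ, (c = 0 ∨ c = 1 / 2 ∨ c = -(1 / 2)) → F x ≠ c := by
      intro c hc h
      refine hxN (Or.inr (Set.mem_iUnion.2 ⟨n, ?_⟩))
      rw [h] at hxeq
      rcases hc with rfl | rfl | rfl
      · exact Or.inl hxeq
      · exact Or.inr (Or.inl hxeq)
      · exact Or.inr (Or.inr hxeq)
    have hFI := hEI hxE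
    refine Set.mem_iUnion.2 ⟨n, hx0, ?_⟩
    rw [← hFx]
    refine ⟨⟨hxE, abs_lt.2 ⟨?_, ?_⟩, hFN _ (by simp)⟩, ?_⟩
    · exact lt_of_le_of_ne hFI.1 (hFN _ (by simp)).symm
    · exact lt_of_le_of_ne hFI.2 (hFN _ (by simp))
    · rw [Set.mem_ofPred_eq, hFx, sub_add_cancel, abs_div, abs_neg, abs_one,
        le_div_iff₀ (abs_pos.2 hx0)]
      linarith [abs_le.2 hxI]
  have hAae : (F ⁻¹' E ∩ Set.Icc (-(1 / 2) : ℝ) (1 / 2) : Set ℝ) =ᵐ[volume] (⋃ n, B n : Set ℝ) := by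
    refine Filter.EventuallyLE.antisymm ?_ hBsub.eventuallyLE
    exact hAsub.eventuallyLE.trans
      (union_ae_eq_left_of_ae_eq_empty (ae_eq_empty.2 (hN.measure_zero _))).le
  have hEae : (E : Set ℝ) =ᵐ[volume] S := by
    have hc : ({0, 1 / 2, -(1 / 2)} : Set ℝ).Countable := (Set.toFinite _).countable
    have hsub : E ⊆ S ∪ {0, 1 / 2, -(1 / 2)} := by
      intro y hy
      by_cases hy' : y ∈ ({0, 1 / 2, -(1 / 2)} : Set ℝ)
      · exact Or.inr hy'
      simp only [Set.mem_insert_iff, Set.mem_singleton_iff, not_or] at hy'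
      exact Or.inl ⟨hy, abs_lt.2 ⟨lt_of_le_of_ne (hEI hy).1 (Ne.symm hy'.2.2),
        lt_of_le_of_ne (hEI hy).2 hy'.2.1⟩, hy'.1⟩
    refine Filter.EventuallyLE.antisymm ?_ Set.inter_subset_left.eventuallyLE
    exact hsub.eventuallyLE.trans
      (union_ae_eq_left_of_ae_eq_empty (ae_eq_empty.2 (hc.measure_zero _))).le
  have hbranch (n : ℤ) : ∫⁻ x in B n, ENNReal.ofReal (evenDensity R x)
      = ∫⁻ y in S, ENNReal.ofReal (transferTerm R y n) := by
    have hderiv : ∀ y ∈ D n, HasDerivWithinAt (fun y : ℝ => -1 / (y + n))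
        (((y + n) ^ 2)⁻¹) (D n) y := by
      intro y hy
      have := ((hasDerivAt_const y (-1 : ℝ)).div ((hasDerivAt_id y).add_const (n : ℝ)) (hne hy))
      refine (this.congr_deriv ?_).hasDerivWithinAt
      simp
    have hinj : Set.InjOn (fun y : ℝ => -1 / (y + n)) (D n) := by
      intro a ha b hb hab
      have := hne ha
      have := hne hb
      simp only at hab
      field_simp at hab
      linarith
    rw [hBimage, lintegral_image_eq_lintegral_abs_deriv_mul (hSm.inter (hDm n)) hderiv hinj]
    calc ∫⁻ y in D n, ENNReal.ofReal |((y + n) ^ 2)⁻¹| *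
          ENNReal.ofReal (evenDensity R (-1 / (y + n)))
        = ∫⁻ y in D n, ENNReal.ofReal (transferTerm R y n) := by
          refine setLIntegral_congr_fun (hSm.inter (hDm n)) fun y hy => ?_
          rw [← ENNReal.ofReal_mul (abs_nonneg _), inv_sq_mul_evenDensity h0 hy.2]
      _ = ∫⁻ y in S, ENNReal.ofReal (transferTerm R y n) := by
          rw [← lintegral_inter_add_sdiff _ S (hDm n)]
          symm
          convert add_zero _ using 2
          rw [setLIntegral_congr_fun (g := fun _ => 0) (hSm.diff (hDm n)), lintegral_zero]
          intro y hy
          simp [transferTerm, if_neg (show ¬ 2 ≤ |y + (n : ℝ)| from hy.2)]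
  have htm (n : ℤ) : Measurable fun y => ENNReal.ofReal (transferTerm R y n) := by
    refine ENNReal.measurable_ofReal.comp (Measurable.ite (hDm n) ?_ measurable_const)
    fun_prop
  rw [hμ, withDensity_apply', withDensity_apply _ hE,
    Measure.restrict_restrict' measurableSet_Icc, Measure.restrict_restrict' measurableSet_Icc,
    Set.inter_eq_left.2 hEI, setLIntegral_congr hAae, setLIntegral_congr hEae,
    lintegral_iUnion hBm hBdisj]
  simp only [hbranch]
  rw [← lintegral_tsum fun n => (htm n).aemeasurable]
  refine setLIntegral_congr_fun hSm fun y hy => ?_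
  have hsum := hasSum_transferTerm h0 h1 hquad hy.2.2 hy.2.1
  rw [← ENNReal.ofReal_tsum_of_nonneg (transferTerm_nonneg h0 y) hsum.summable, hsum.tsum_eq]
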